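/- Let γ be a translation-invariant monotonicity-preserving specification, γ^(±) the associated right- and left-continuous specifications, and μ⁺ = lim_{Λ↑𝕃} γ_Λ(·|+). If μ is a translation-invariant probability measure with h(μ|μ⁺) = 0 and μ(Ω_±) = 1, where Ω_± = {ω ∈ Ω : γ^(+)_Λ(f|ω) = γ^(−)_Λ(f|ω) for all local f and all Λ ∈ 𝒮}, then μ ∈ 𝒢(γ^(+)), and thus μ is almost quasilocal. The analogous statement holds with '+' and '−' interchanged. -/

import Mathlib

open MeasureTheory Filter Topology
open scoped ENNReal MeasureTheory Classical

noncomputable section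

/-- The σ-algebra on configuration space generated by the coordinates in `Δ`. -/
def cylinderSigma (Ω₀ : Type*) [MeasurableSpace Ω₀] {ι : Type*} (Δ : Set ι) :
    MeasurableSpace (ι → Ω₀) :=
  MeasurableSpace.comap (fun ω (x : Δ) => ω (x : ι)) MeasurableSpace.pi

/-- The configuration agreeing with `ω` on `S` and with `θ` off `S`. -/
def splice {ι Ω₀ : Type*} (S : Set ι) (ω θ : ι → Ω₀) : ι → Ω₀ :=
  fun x => if x ∈ S then ω x else θ x

/-- A function is local if it is measurable with respect to a finite cylinder σ-algebra. -/
def IsLocal {ι Ω₀ : Type*} [MeasurableSpace Ω₀] (f : (ι → Ω₀) → ℝ) : Prop :=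
  ∃ Δ : Finset ι, Measurable[cylinderSigma Ω₀ (Δ : Set ι)] f

/-- Quasilocality of `f` in the direction `θ`. -/
def QuasilocalInDir {ι Ω₀ : Type*} (θ : ι → Ω₀) (f : (ι → Ω₀) → ℝ) : Prop :=
  ∀ ω, Tendsto (fun S : Finset ι => f (splice (S : Set ι) ω θ)) atTop (𝓝 (f ω))

/-- `f` is quasilocal: a uniform limit of local functions. -/
def IsQuasilocal {ι Ω₀ : Type*} [MeasurableSpace Ω₀] (f : (ι → Ω₀) → ℝ) : Prop :=
  ∀ ε : ℝ, 0 < ε → ∃ g, IsLocal g ∧ ∀ ω, |f ω - g ω| ≤ ε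

/-- A specification: a proper consistent family of probability kernels indexed by
finite subsets of the site space. -/
structure Specification (ι Ω₀ : Type*) [MeasurableSpace Ω₀] where
  k : Finset ι → (ι → Ω₀) → Measure (ι → Ω₀)
  isProb : ∀ Λ ω, IsProbabilityMeasure (k Λ ω)
  meas : ∀ (Λ : Finset ι) (A : Set (ι → Ω₀)), MeasurableSet A →
    Measurable[cylinderSigma Ω₀ ((Λ : Set ι))ᶜ] (fun ω => k Λ ω A)
  proper : ∀ (Λ : Finset ι) (B : Set (ι → Ω₀)),
    MeasurableSet[cylinderSigma Ω₀ ((Λ : Set ι))ᶜ] B → ∀ ω, k Λ ω B = B.indicator 1 ω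
  consistent : ∀ ⦃Λ Λ' : Finset ι⦄, Λ ⊆ Λ' → ∀ ω, (k Λ' ω).bind (k Λ) = k Λ' ω

/-- `γ_Λ f`, the expectation of `f` under the kernel of the specification. -/
def specInt {ι Ω₀ : Type*} [MeasurableSpace Ω₀] (γ : Specification ι Ω₀)
    (Λ : Finset ι) (f : (ι → Ω₀) → ℝ) (ω : ι → Ω₀) : ℝ :=
  ∫ x, f x ∂(γ.k Λ ω)

/-- DLR consistency of a measure with a specification. -/
def IsGibbs {ι Ω₀ : Type*} [MeasurableSpace Ω₀] (γ : Specification ι Ω₀)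
    (μ : Measure (ι → Ω₀)) : Prop :=
  ∀ Λ, μ.bind (γ.k Λ) = μ

/-- A specification is quasilocal in the direction `θ`. -/
def SpecQuasilocalInDir {ι Ω₀ : Type*} [MeasurableSpace Ω₀] (γ : Specification ι Ω₀)
    (θ : ι → Ω₀) : Prop :=
  ∀ Λ f, IsLocal f → QuasilocalInDir θ (specInt γ Λ f)

/-- A quasilocal specification. -/
def IsSpecQuasilocal {ι Ω₀ : Type*} [MeasurableSpace Ω₀] (γ : Specification ι Ω₀) : Prop :=
  ∀ Λ f, IsLocal f → IsQuasilocal (specInt γ Λ f)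

/-- A monotonicity-preserving specification. -/
def MonoPreserving {ι Ω₀ : Type*} [MeasurableSpace Ω₀] [Preorder Ω₀]
    (γ : Specification ι Ω₀) : Prop :=
  ∀ Λ (f : (ι → Ω₀) → ℝ), Measurable f → Monotone f → Monotone (specInt γ Λ f)

/-- `γ'` is the limit of `γ` with boundary condition forced to `θ` outside larger
and larger volumes. -/
def IsDirLimitSpec {ι Ω₀ : Type*} [MeasurableSpace Ω₀] (γ γ' : Specification ι Ω₀)
    (θ : ι → Ω₀) : Prop :=
  ∀ Λ f, IsLocal f → ∀ ω,
    Tendsto (fun S : Finset ι => specInt γ Λ f (splice (S : Set ι) ω θ)) atTop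
      (𝓝 (specInt γ' Λ f ω))

/-- `μ` is the weak limit `lim_{Λ↑𝕃} γ_Λ(⬝|θ)`. -/
def IsLimitWithBoundary {ι Ω₀ : Type*} [MeasurableSpace Ω₀] (γ : Specification ι Ω₀)
    (θ : ι → Ω₀) (μ : Measure (ι → Ω₀)) : Prop :=
  IsProbabilityMeasure μ ∧
    ∀ f, IsLocal f → Tendsto (fun Λ : Finset ι => specInt γ Λ f θ) atTop (𝓝 (∫ ω, f ω ∂μ))

/-- The set of configurations at which all the `γ_Λ f` (`f` local) are continuous. -/
def contSet {ι Ω₀ : Type*} [MeasurableSpace Ω₀] [TopologicalSpace Ω₀]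
    (γ : Specification ι Ω₀) : Set (ι → Ω₀) :=
  {ω | ∀ Λ f, IsLocal f → ContinuousAt (specInt γ Λ f) ω}

/-- An almost quasilocal probability measure. -/
def AlmostQuasilocal {ι Ω₀ : Type*} [MeasurableSpace Ω₀] [TopologicalSpace Ω₀]
    (μ : Measure (ι → Ω₀)) : Prop :=
  ∃ γ : Specification ι Ω₀, IsGibbs γ μ ∧ μ (contSet γ) = 1

/-- Sites of the lattice `ℤ^d`. -/
abbrev Site (d : ℕ) := Fin d → ℤ

/-- The cube `Λ_n = ([-n,n] ∩ ℤ)^d`. -/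
def cube (d : ℕ) (n : ℕ) : Finset (Site d) :=
  Fintype.piFinset fun _ => Finset.Icc (-(n : ℤ)) (n : ℤ)

/-- Translation of a configuration by `i`. -/
def shift {Ω₀ : Type*} {d : ℕ} (i : Site d) (ω : Site d → Ω₀) : Site d → Ω₀ :=
  fun x => ω (x - i)

/-- Translation invariance of a measure. -/
def TransInv {Ω₀ : Type*} [MeasurableSpace Ω₀] {d : ℕ} (μ : Measure (Site d → Ω₀)) : Prop :=
  ∀ i : Site d, μ.map (shift i) = μ

/-- Translation invariance of a specification. -/
def TransInvSpec {Ω₀ : Type*} [MeasurableSpace Ω₀] {d : ℕ}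
    (γ : Specification (Site d) Ω₀) : Prop :=
  ∀ (i : Site d) (Λ : Finset (Site d)) (ω),
    γ.k (Λ.image (· + i)) (shift i ω) = (γ.k Λ ω).map (shift i)

/-- Restriction (projection) of a measure to the coordinates in `Δ`. -/
def restrictTo {ι Ω₀ : Type*} [MeasurableSpace Ω₀] (Δ : Finset ι)
    (μ : Measure (ι → Ω₀)) : Measure ({x // x ∈ Δ} → Ω₀) :=
  μ.map (fun ω (x : {x // x ∈ Δ}) => ω (x : ι))

/-- The Radon–Nikodym density `dμ_Δ/dν_Δ`, viewed as a function on configuration space. -/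
def density {ι Ω₀ : Type*} [MeasurableSpace Ω₀] (Δ : Finset ι)
    (μ ν : Measure (ι → Ω₀)) : (ι → Ω₀) → ℝ :=
  fun ω => ((restrictTo Δ μ).rnDeriv (restrictTo Δ ν) (fun x : {x // x ∈ Δ} => ω (x : ι))).toReal

/-- Relative entropy `H_Δ(μ|ν)` at the finite volume `Δ` (`+∞` if `μ_Δ` is not
absolutely continuous with respect to `ν_Δ`). -/
def relEnt {ι Ω₀ : Type*} [MeasurableSpace Ω₀] (Δ : Finset ι)
    (μ ν : Measure (ι → Ω₀)) : ℝ≥0∞ :=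
  if restrictTo Δ μ ≪ restrictTo Δ ν then
    ENNReal.ofReal (∫ ω, density Δ μ ν ω * Real.log (density Δ μ ν ω) ∂ν)
  else ⊤

/-- Vanishing relative entropy density: `h(μ|ν) = 0`. -/
def EntDensityZero {Ω₀ : Type*} [MeasurableSpace Ω₀] {d : ℕ}
    (μ ν : Measure (Site d → Ω₀)) : Prop :=
  Tendsto (fun n => relEnt (cube d n) μ ν / ((cube d n).card : ℝ≥0∞)) atTop (𝓝 0)


/-- The set `Ω_±` of configurations on which the plus- and minus-limit specifications
agree (on all local functions and finite volumes). -/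
def agreeSet {ι Ω₀ : Type*} [MeasurableSpace Ω₀] (γp γm : Specification ι Ω₀) :
    Set (ι → Ω₀) :=
  {ω | ∀ Λ f, IsLocal f → specInt γp Λ f ω = specInt γm Λ f ω}

set_option linter.unusedSectionVars false

section Helpers

variable {ι Ω₀ : Type*} [MeasurableSpace Ω₀]

lemma zr_dep_of_meas {β : Type*} [MeasurableSpace β] [MeasurableSingletonClass β]
    {Δ : Set ι} {f : (ι → Ω₀) → β}
    (hf : Measurable[cylinderSigma Ω₀ Δ] f) : DependsOn f Δ := by
  intro x y hxy
  have h := hf (measurableSet_singleton (f x))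
  obtain ⟨s, -, hs⟩ := h
  have hx : x ∈ f ⁻¹' {f x} := rfl
  rw [← hs] at hx
  have hxy' : (fun (i : Δ) => x i) = fun (i : Δ) => y i := by
    ext i; exact hxy i i.2
  have hy : y ∈ f ⁻¹' {f x} := by
    rw [← hs]
    change (fun (i : Δ) => y i) ∈ s
    rw [← hxy']; exact hx
  exact (hy : f y = f x).symm

lemma zr_cyl_le (Δ : Set ι) : cylinderSigma Ω₀ Δ ≤ MeasurableSpace.pi := by
  have h : Measurable (fun (ω : ι → Ω₀) (x : Δ) => ω (x : ι)) :=
    measurable_pi_lambda _ fun i => measurable_pi_apply _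
  exact h.comap_le

variable [Finite Ω₀] [DiscreteMeasurableSpace Ω₀] [Nonempty Ω₀]

lemma zr_meas_of_dep {β : Type*} [MeasurableSpace β] [Nonempty β] {Δ : Finset ι}
    {f : (ι → Ω₀) → β}
    (hf : DependsOn f (Δ : Set ι)) : Measurable[cylinderSigma Ω₀ (Δ : Set ι)] f := by
  obtain ⟨g, hg⟩ := dependsOn_iff_exists_comp.1 hf
  subst hg
  have : Finite (Δ : Set ι) := Finite.of_fintype Δ
  have hg : Measurable g := measurable_of_countable _
  intro s hs
  exact ⟨g ⁻¹' s, hg hs, rfl⟩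

lemma zr_meas {β : Type*} [MeasurableSpace β] [Nonempty β] {Δ : Finset ι}
    {f : (ι → Ω₀) → β}
    (hf : DependsOn f (Δ : Set ι)) : Measurable f :=
  (zr_meas_of_dep hf).mono (zr_cyl_le _) le_rfl

lemma zr_bdd {Δ : Finset ι} {f : (ι → Ω₀) → ℝ}
    (hf : DependsOn f (Δ : Set ι)) : ∃ M, 0 < M ∧ ∀ ω, |f ω| ≤ M := by
  obtain ⟨g, hg⟩ := dependsOn_iff_exists_comp.1 hf
  subst hg
  have : Finite (Δ : Set ι) := Finite.of_fintype Δ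
  obtain ⟨M, hM⟩ := (Set.finite_range (fun x => |g x|)).bddAbove
  exact ⟨max M 1, by positivity, fun ω => le_max_of_le_left (hM ⟨_, rfl⟩)⟩

lemma zr_int {Δ : Finset ι} {f : (ι → Ω₀) → ℝ}
    (hf : DependsOn f (Δ : Set ι)) (μ : Measure (ι → Ω₀)) [IsFiniteMeasure μ] :
    Integrable f μ := by
  obtain ⟨M, -, hM⟩ := zr_bdd hf
  exact Integrable.of_bound (zr_meas hf).aestronglyMeasurable M (Eventually.of_forall hM)

lemma zr_dep_mono {β : Type*} {s t : Set ι} {f : (ι → Ω₀) → β} (h : DependsOn f s) (hst : s ⊆ t) :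
    DependsOn f t := fun _ _ hxy => h fun i hi => hxy i (hst hi)

lemma zr_dep_comp {β δ : Type*} {s : Set ι} {f : (ι → Ω₀) → β} (h : DependsOn f s) (u : β → δ) :
    DependsOn (fun ω => u (f ω)) s := fun _ _ hxy => congrArg u (h hxy)

lemma zr_dep_comp2 {β δ ε : Type*} {s : Set ι} {f : (ι → Ω₀) → β} {g : (ι → Ω₀) → δ}
    (h : DependsOn f s) (h' : DependsOn g s) (u : β → δ → ε) :
    DependsOn (fun ω => u (f ω) (g ω)) s := fun _ _ hxy => by
  simp only [h hxy, h' hxy]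

lemma zr_local_iff {f : (ι → Ω₀) → ℝ} : IsLocal f ↔ ∃ Δ : Finset ι, DependsOn f (Δ : Set ι) :=
  ⟨fun ⟨Δ, h⟩ => ⟨Δ, zr_dep_of_meas h⟩, fun ⟨Δ, h⟩ => ⟨Δ, zr_meas_of_dep h⟩⟩

/-- kernels depend only on the outside -/
lemma zr_k_eq (γ : Specification ι Ω₀) (Λ : Finset ι) {x y : ι → Ω₀}
    (hxy : ∀ i, i ∉ Λ → x i = y i) : γ.k Λ x = γ.k Λ y := by
  refine Measure.ext fun A hA => ?_
  exact zr_dep_of_meas (γ.meas Λ A hA) (fun i hi => hxy i (by simpa using hi))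

lemma zr_k_meas (γ : Specification ι Ω₀) (Λ : Finset ι) : Measurable (γ.k Λ) :=
  Measure.measurable_of_measurable_coe _ fun A hA => (γ.meas Λ A hA).mono (zr_cyl_le _) le_rfl

lemma zr_integral_bind {α β : Type*} [MeasurableSpace α] [MeasurableSpace β] (m : Measure α)
    [SFinite m] (κ : α → Measure β) (hκ : Measurable κ) (hp : ∀ a, IsProbabilityMeasure (κ a))
    {f : β → ℝ} (hf : Integrable f (m.bind κ)) :
    ∫ x, f x ∂(m.bind κ) = ∫ a, ∫ x, f x ∂(κ a) ∂m := by
  let K : ProbabilityTheory.Kernel α β := ⟨κ, hκ⟩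
  have : ProbabilityTheory.IsMarkovKernel K := ⟨hp⟩
  exact ProbabilityTheory.Kernel.integral_comp (η := K)
    (κ := ProbabilityTheory.Kernel.const Unit m) (a := ()) 
    (by rw [ProbabilityTheory.Kernel.comp_apply]; exact hf)

lemma zr_specInt_pull (γ : Specification ι Ω₀) (Λ T : Finset ι) (hT : Disjoint T Λ)
    {h : (ι → Ω₀) → ℝ} (hh : DependsOn h (T : Set ι)) (g : (ι → Ω₀) → ℝ) (ω : ι → Ω₀) :
    specInt γ Λ (fun x => h x * g x) ω = h ω * specInt γ Λ g ω := by
  have := γ.isProb Λ ω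
  have hm : MeasurableSet[cylinderSigma Ω₀ ((Λ : Set ι))ᶜ] {x | h x = h ω} := by
    have h1 := zr_meas_of_dep hh (measurableSet_singleton (h ω))
    obtain ⟨s, hs, hs'⟩ := h1
    refine ⟨(fun (w : ((Λ : Set ι)ᶜ : Set ι) → Ω₀) (i : (T : Set ι)) =>
      w ⟨i.1, by
        have := i.2
        simp only [Set.mem_compl_iff, Finset.mem_coe]
        exact Finset.disjoint_left.1 hT (by simpa using this)⟩) ⁻¹' s, ?_, ?_⟩
    · exact measurable_pi_lambda _ (fun i => measurable_pi_apply _) hs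
    · rw [← Set.preimage_comp]; exact hs'
  have h1 := γ.proper Λ _ hm ω
  rw [Set.indicator_of_mem (by simp)] at h1
  have h2 : ∀ᵐ x ∂(γ.k Λ ω), h x = h ω := by
    have := (prob_compl_eq_zero_iff (μ := γ.k Λ ω) (zr_cyl_le _ _ hm)).2 (by simp [h1])
    exact this
  unfold specInt
  rw [← integral_const_mul]
  exact integral_congr_ae (h2.mono fun x hx => by simp only [hx])

lemma zr_specInt_consistent (γ : Specification ι Ω₀) {Λ V : Finset ι} (hV : Λ ⊆ V)
    {f : (ι → Ω₀) → ℝ} {Δ : Finset ι} (hf : DependsOn f (Δ : Set ι)) (θ : ι → Ω₀) :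
    specInt γ V f θ = ∫ ω, specInt γ Λ f ω ∂(γ.k V θ) := by
  have := γ.isProb V θ
  unfold specInt
  conv_lhs => rw [← γ.consistent hV θ]
  refine zr_integral_bind _ _ (zr_k_meas γ Λ) (γ.isProb Λ) ?_
  rw [γ.consistent hV θ]
  exact zr_int hf _

lemma zr_specInt_bdd (γ : Specification ι Ω₀) (Λ : Finset ι) {f : (ι → Ω₀) → ℝ} {M : ℝ}
    (hM : ∀ ω, |f ω| ≤ M) (ω : ι → Ω₀) : |specInt γ Λ f ω| ≤ M := by
  have := γ.isProb Λ ω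
  unfold specInt
  have := norm_integral_le_of_norm_le_const (μ := γ.k Λ ω) (f := f) (C := M)
    (Eventually.of_forall hM)
  simpa using this

lemma zr_specInt_meas (γ : Specification ι Ω₀) (Λ : Finset ι) {f : (ι → Ω₀) → ℝ}
    (hf : Measurable f) : Measurable (specInt γ Λ f) := by
  let K : ProbabilityTheory.Kernel (ι → Ω₀) (ι → Ω₀) := ⟨γ.k Λ, zr_k_meas γ Λ⟩
  have : ProbabilityTheory.IsMarkovKernel K := ⟨γ.isProb Λ⟩
  have h := hf.stronglyMeasurable.integral_kernel (κ := K)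
  exact h.measurable

/-- the boundary-frozen expectations -/
def zrU (γ : Specification ι Ω₀) (θ : ι → Ω₀) (Λ S : Finset ι) (g : (ι → Ω₀) → ℝ) :
    (ι → Ω₀) → ℝ := fun ω => specInt γ Λ g (splice (S : Set ι) ω θ)

lemma zrU_dep (γ : Specification ι Ω₀) (θ : ι → Ω₀) (Λ S : Finset ι) (g : (ι → Ω₀) → ℝ) :
    DependsOn (zrU γ θ Λ S g) ((S \ Λ : Finset ι) : Set ι) := by
  intro x y hxy
  unfold zrU specInt
  rw [zr_k_eq γ Λ (x := splice (S : Set ι) x θ) (y := splice (S : Set ι) y θ)]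
  intro i hi
  unfold splice
  split_ifs with h
  · exact hxy i (by simpa using ⟨h, hi⟩)
  · rfl

/-- monotone comparison passes to the limit measure -/
lemma zr_limit_le (γ : Specification ι Ω₀) (θ : ι → Ω₀) (ν : Measure (ι → Ω₀))
    (hν : IsLimitWithBoundary γ θ ν) (Λ T D D' : Finset ι) (hT : Disjoint T Λ)
    {h g u : (ι → Ω₀) → ℝ} (hh : DependsOn h (T : Set ι)) (hh0 : ∀ ω, 0 ≤ h ω)
    (hg : DependsOn g (D : Set ι)) (hu : DependsOn u (D' : Set ι)) 
    (hle : ∀ ω, specInt γ Λ g ω ≤ u ω) :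
    ∫ ω, h ω * g ω ∂ν ≤ ∫ ω, h ω * u ω ∂ν := by
  have e1 : DependsOn (fun ω => h ω * g ω) ((T ∪ D : Finset ι) : Set ι) :=
    zr_dep_comp2 (zr_dep_mono hh (by simp)) (zr_dep_mono hg (by simp)) _
  have e2 : DependsOn (fun ω => h ω * u ω) ((T ∪ D' : Finset ι) : Set ι) :=
    zr_dep_comp2 (zr_dep_mono hh (by simp)) (zr_dep_mono hu (by simp)) _
  refine le_of_tendsto_of_tendsto (hν.2 _ (zr_local_iff.2 ⟨_, e1⟩))
    (hν.2 _ (zr_local_iff.2 ⟨_, e2⟩)) ?_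
  filter_upwards [eventually_ge_atTop Λ] with V hV
  rw [zr_specInt_consistent γ hV e1]
  have := γ.isProb V θ
  obtain ⟨M, -, hM⟩ := zr_bdd e1
  refine integral_mono ?_ (zr_int e2 _) fun ω => ?_
  · exact Integrable.of_bound (zr_specInt_meas γ Λ (zr_meas e1)).aestronglyMeasurable M
      (Eventually.of_forall fun ω => zr_specInt_bdd γ Λ hM ω)
  · simp only
    rw [zr_specInt_pull γ Λ T hT hh]
    exact mul_le_mul_of_nonneg_left (hle ω) (hh0 ω)

lemma zr_dens_dep (Δ : Finset ι) (μ ν : Measure (ι → Ω₀)) :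
    DependsOn (density Δ μ ν) (Δ : Set ι) := by
  intro x y hxy
  unfold density
  have : (fun i : {i // i ∈ Δ} => x i) = fun i : {i // i ∈ Δ} => y i := by
    ext i; exact hxy i i.2
  rw [this]

lemma zr_dens_nonneg (Δ : Finset ι) (μ ν : Measure (ι → Ω₀)) (ω : ι → Ω₀) :
    0 ≤ density Δ μ ν ω := ENNReal.toReal_nonneg

lemma zr_restr_meas (Δ : Finset ι) :
    Measurable (fun (ω : ι → Ω₀) (x : {x // x ∈ Δ}) => ω (x : ι)) :=
  measurable_pi_lambda _ fun i => measurable_pi_apply _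

lemma zr_dens_int {Δ : Finset ι} {μ ν : Measure (ι → Ω₀)} [IsProbabilityMeasure μ]
    [IsProbabilityMeasure ν] (hac : restrictTo Δ μ ≪ restrictTo Δ ν)
    {g : (ι → Ω₀) → ℝ} (hg : DependsOn g (Δ : Set ι)) :
    ∫ ω, density Δ μ ν ω * g ω ∂ν = ∫ ω, g ω ∂μ := by
  obtain ⟨g', hg'⟩ := dependsOn_iff_exists_comp.1 hg
  have hm := zr_restr_meas (Ω₀ := Ω₀) Δ
  have : IsProbabilityMeasure (restrictTo Δ μ) := Measure.isProbabilityMeasure_map hm.aemeasurable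
  have : IsProbabilityMeasure (restrictTo Δ ν) := Measure.isProbabilityMeasure_map hm.aemeasurable
  have h := integral_toReal_rnDeriv_mul hac (f := g')
  have hfm : ∀ (f : ({x // x ∈ Δ} → Ω₀) → ℝ) (m : Measure ({x // x ∈ Δ} → Ω₀)),
      AEStronglyMeasurable f m := fun f m => (measurable_of_countable f).aestronglyMeasurable
  rw [restrictTo, restrictTo, integral_map hm.aemeasurable (hfm _ _),
    integral_map hm.aemeasurable (hfm _ _)] at h
  subst hg'
  exact h

lemma zr_ac_mono {Δ Δ' : Finset ι} (hs : Δ' ⊆ Δ) {μ ν : Measure (ι → Ω₀)}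
    (hac : restrictTo Δ μ ≪ restrictTo Δ ν) : restrictTo Δ' μ ≪ restrictTo Δ' ν := by
  have hp : Measurable (fun (w : {x // x ∈ Δ} → Ω₀) (i : {x // x ∈ Δ'}) => w ⟨i.1, hs i.2⟩) :=
    measurable_pi_lambda _ fun i => measurable_pi_apply _
  have h := hac.map hp
  unfold restrictTo at h
  rw [Measure.map_map hp (zr_restr_meas Δ), Measure.map_map hp (zr_restr_meas Δ)] at h
  exact h

lemma zr_real_ineq {F G : ℝ} (hF : 0 ≤ F) (hG : 0 ≤ G) (h : G = 0 → F = 0) :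
    F - G + (√F - √G) ^ 2 ≤ F * Real.log F - F * Real.log G := by
  rcases hF.eq_or_lt with rfl | hF'
  · simp [Real.sq_sqrt hG]
  have hG' : 0 < G := lt_of_le_of_ne hG fun h0 => hF'.ne' (h h0.symm)
  have ha : 0 < √F := Real.sqrt_pos.2 hF'
  have hb : 0 < √G := Real.sqrt_pos.2 hG'
  have h1 := Real.log_le_sub_one_of_pos (div_pos hb ha)
  rw [Real.log_div hb.ne' ha.ne', Real.log_sqrt hF, Real.log_sqrt hG] at h1
  have h2 : F * (√G / √F) = √F * √G := by
    field_simp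
    rw [Real.sq_sqrt hF]
  have h3 := mul_le_mul_of_nonneg_left h1 hF
  rw [mul_sub, mul_sub, h2] at h3
  have := Real.sq_sqrt hF
  have := Real.sq_sqrt hG
  nlinarith

/-- real-valued finite-volume entropy -/
def zrEnt (Δ : Finset ι) (μ ν : Measure (ι → Ω₀)) : ℝ :=
  ∫ ω, density Δ μ ν ω * Real.log (density Δ μ ν ω) ∂ν

lemma zr_dens_one {Δ : Finset ι} {μ ν : Measure (ι → Ω₀)} [IsProbabilityMeasure μ]
    [IsProbabilityMeasure ν] (hac : restrictTo Δ μ ≪ restrictTo Δ ν) :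
    ∫ ω, density Δ μ ν ω ∂ν = 1 := by
  have := zr_dens_int hac (g := fun _ => 1) (fun _ _ _ => rfl)
  simpa using this

lemma zrEnt_nonneg {Δ : Finset ι} {μ ν : Measure (ι → Ω₀)} [IsProbabilityMeasure μ]
    [IsProbabilityMeasure ν] (hac : restrictTo Δ μ ≪ restrictTo Δ ν) : 0 ≤ zrEnt Δ μ ν := by
  have hd := zr_dens_dep Δ μ ν
  have h1 : ∫ ω, (density Δ μ ν ω - 1) ∂ν = 0 := by
    rw [integral_sub (zr_int hd _) (integrable_const _), zr_dens_one hac]; simp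
  rw [← h1]
  refine integral_mono (zr_int (zr_dep_comp hd (fun t => t - 1)) _)
    (zr_int (zr_dep_comp hd (fun t => t * Real.log t)) _) fun ω => ?_
  have := zr_real_ineq (zr_dens_nonneg Δ μ ν ω) zero_le_one (by simp)
  simp only [Real.log_one, mul_zero, sub_zero] at this
  nlinarith [sq_nonneg (√(density Δ μ ν ω) - √1)]

lemma zrEnt_diff {Δ Δ' : Finset ι} (hs : Δ' ⊆ Δ) {μ ν : Measure (ι → Ω₀)} [IsProbabilityMeasure μ]
    [IsProbabilityMeasure ν] (hac : restrictTo Δ μ ≪ restrictTo Δ ν) :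
    ∫ ω, (√(density Δ μ ν ω) - √(density Δ' μ ν ω)) ^ 2 ∂ν ≤ zrEnt Δ μ ν - zrEnt Δ' μ ν := by
  have hac' := zr_ac_mono hs hac
  have hs' : (Δ' : Set ι) ⊆ (Δ : Set ι) := by simpa using hs
  have hF := zr_dens_dep Δ μ ν
  have hG' := zr_dens_dep Δ' μ ν
  have hG := zr_dep_mono hG' hs'
  set F := density Δ μ ν with hFdef
  set G := density Δ' μ ν with hGdef
  have hFG : ∀ᵐ ω ∂ν, G ω = 0 → F ω = 0 := by
    have hi : DependsOn (fun ω => if G ω = 0 then (1 : ℝ) else 0) (Δ' : Set ι) :=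
      zr_dep_comp hG' (fun t => if t = 0 then (1 : ℝ) else 0)
    have h1 := zr_dens_int hac (zr_dep_mono hi hs')
    have h2 := zr_dens_int hac' hi
    rw [← h2] at h1
    have h3 : ∫ ω, G ω * (if G ω = 0 then (1 : ℝ) else 0) ∂ν = 0 := by
      rw [← integral_zero (ι → Ω₀) ℝ (μ := ν)]
      congr 1
      ext ω
      by_cases h : G ω = 0 <;> simp [h]
    rw [h3] at h1
    rw [integral_eq_zero_iff_of_nonneg] at h1
    · filter_upwards [h1] with ω hω h0
      simpa [h0] using hω
    · intro ω
      have := zr_dens_nonneg Δ μ ν ω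
      simp only [Pi.zero_apply]
      split_ifs <;> simp [this]
    · exact zr_int (zr_dep_comp2 hF (zr_dep_mono hi hs') (fun a b => a * b)) _
  have e1 : zrEnt Δ' μ ν = ∫ ω, F ω * Real.log (G ω) ∂ν := by
    unfold zrEnt
    rw [zr_dens_int hac' (zr_dep_comp hG' Real.log), zr_dens_int hac (zr_dep_comp hG Real.log)]
  rw [e1]
  unfold zrEnt
  rw [← integral_sub (zr_int (zr_dep_comp hF (fun t => t * Real.log t)) _)
    (zr_int (zr_dep_comp2 hF hG (fun a b => a * Real.log b)) _)]
  have e2 : ∫ ω, (F ω - G ω) ∂ν = 0 := by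
    rw [integral_sub (zr_int hF _) (zr_int hG _), zr_dens_one hac, zr_dens_one hac', sub_self]
  have e3 : ∫ ω, (√(F ω) - √(G ω)) ^ 2 ∂ν = ∫ ω, (F ω - G ω + (√(F ω) - √(G ω)) ^ 2) ∂ν := by
    rw [integral_add (zr_int (zr_dep_comp2 hF hG (fun a b => a - b)) _)
      (zr_int (zr_dep_comp2 hF hG (fun a b => (√a - √b) ^ 2)) _), e2, zero_add]
  rw [e3]
  refine integral_mono_ae (zr_int (zr_dep_comp2 hF hG (fun a b => a - b + (√a - √b) ^ 2)) _)
    (zr_int (zr_dep_comp2 hF hG (fun a b => a * Real.log a - a * Real.log b)) _) ?_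
  filter_upwards [hFG] with ω hω
  exact zr_real_ineq (zr_dens_nonneg _ _ _ ω) (zr_dens_nonneg _ _ _ ω) hω

lemma zrEnt_mono {Δ Δ' : Finset ι} (hs : Δ' ⊆ Δ) {μ ν : Measure (ι → Ω₀)} [IsProbabilityMeasure μ]
    [IsProbabilityMeasure ν] (hac : restrictTo Δ μ ≪ restrictTo Δ ν) :
    zrEnt Δ' μ ν ≤ zrEnt Δ μ ν := by
  have h := zrEnt_diff hs hac
  have : 0 ≤ ∫ ω, (√(density Δ μ ν ω) - √(density Δ' μ ν ω)) ^ 2 ∂ν :=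
    integral_nonneg fun ω => sq_nonneg _
  linarith

lemma zr_abs_ineq {F G δ : ℝ} (hF : 0 ≤ F) (hG : 0 ≤ G) (hδ : 0 < δ) :
    |F - G| ≤ (√F - √G) ^ 2 / (2 * δ) + δ * (F + G) := by
  have h1 : F - G = (√F - √G) * (√F + √G) := by
    have := Real.sq_sqrt hF
    have := Real.sq_sqrt hG
    nlinarith
  have h2 : (√F + √G) ^ 2 ≤ 2 * (F + G) := by
    have := Real.sq_sqrt hF
    have := Real.sq_sqrt hG
    nlinarith [sq_nonneg (√F - √G)]
  rw [h1, abs_mul, abs_of_nonneg (add_nonneg (Real.sqrt_nonneg F) (Real.sqrt_nonneg G))]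
  set a := |√F - √G| with ha
  have ha2 : (√F - √G) ^ 2 = a ^ 2 := (sq_abs _).symm
  rw [ha2]
  set b := √F + √G
  have h3 : a * b ≤ a ^ 2 / (2 * δ) + δ * b ^ 2 / 2 := by
    rw [← sub_nonneg]
    have : a ^ 2 / (2 * δ) + δ * b ^ 2 / 2 - a * b = (a - δ * b) ^ 2 / (2 * δ) := by
      field_simp; ring
    rw [this]; positivity
  nlinarith

lemma zr_pinsker {Δ Δ' : Finset ι} (hs : Δ' ⊆ Δ) {μ ν : Measure (ι → Ω₀)} [IsProbabilityMeasure μ]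
    [IsProbabilityMeasure ν] (hac : restrictTo Δ μ ≪ restrictTo Δ ν)
    {g : (ι → Ω₀) → ℝ} (hg : DependsOn g (Δ : Set ι)) {M δ : ℝ} (hM : ∀ ω, |g ω| ≤ M)
    (hM0 : 0 < M) (hδ : 0 < δ) :
    |∫ ω, g ω ∂μ - ∫ ω, density Δ' μ ν ω * g ω ∂ν| ≤
      M * ((zrEnt Δ μ ν - zrEnt Δ' μ ν) / (2 * δ) + 2 * δ) := by
  have hac' := zr_ac_mono hs hac
  have hs' : (Δ' : Set ι) ⊆ (Δ : Set ι) := by simpa using hs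
  have hF := zr_dens_dep Δ μ ν
  have hG := zr_dep_mono (zr_dens_dep Δ' μ ν) hs'
  have hd := zrEnt_diff hs hac
  have o1 := zr_dens_one hac
  have o2 := zr_dens_one hac'
  rw [← zr_dens_int hac hg]
  have nF := zr_dens_nonneg Δ μ ν
  have nG := zr_dens_nonneg Δ' μ ν
  set F := density Δ μ ν with hFdef
  set G := density Δ' μ ν with hGdef
  rw [← integral_sub (zr_int (zr_dep_comp2 hF hg (fun a b => a * b)) _)
    (zr_int (zr_dep_comp2 hG hg (fun a b => a * b)) _)]
  have hq := zr_int (zr_dep_comp2 hF hG (fun a b => (√a - √b) ^ 2 / (2 * δ))) ν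
  have hp := zr_int (zr_dep_comp2 hF hG (fun a b => δ * (a + b))) ν
  calc |∫ ω, (F ω * g ω - G ω * g ω) ∂ν|
      ≤ ∫ ω, |F ω * g ω - G ω * g ω| ∂ν := abs_integral_le_integral_abs
    _ ≤ ∫ ω, M * ((√(F ω) - √(G ω)) ^ 2 / (2 * δ) + δ * (F ω + G ω)) ∂ν := by
        refine integral_mono
          (zr_int (zr_dep_comp2 (zr_dep_comp2 hF hg (fun a b => a * b))
            (zr_dep_comp2 hG hg (fun a b => a * b)) (fun a b => |a - b|)) _)
          ((hq.add hp).const_mul M) fun ω => ?_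
        simp only
        rw [← sub_mul, abs_mul, mul_comm]
        exact mul_le_mul (hM ω) (zr_abs_ineq (nF ω) (nG ω) hδ) (abs_nonneg _) hM0.le
    _ = M * ((∫ ω, (√(F ω) - √(G ω)) ^ 2 ∂ν) / (2 * δ) + 2 * δ) := by
        rw [integral_const_mul, integral_add hq hp, integral_div, integral_const_mul,
          integral_add (zr_int hF _) (zr_int hG _), o1, o2]
        ring
    _ ≤ _ := by gcongr

end Helpers

section Lattice

variable {Ω₀ : Type*} [MeasurableSpace Ω₀] [Finite Ω₀] [DiscreteMeasurableSpace Ω₀] [Nonempty Ω₀]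
  {d : ℕ}

lemma zr_shift_meas (i : Site d) : Measurable (shift (Ω₀ := Ω₀) i) :=
  measurable_pi_lambda _ fun _ => measurable_pi_apply _

lemma zr_shift_shift (i : Site d) (ω : Site d → Ω₀) : shift i (shift (-i) ω) = ω := by
  ext x; simp [shift]

lemma zr_shift_shift' (i : Site d) (ω : Site d → Ω₀) : shift (-i) (shift i ω) = ω := by
  ext x; simp [shift]

lemma zr_dep_shift {g : (Site d → Ω₀) → ℝ} {D : Finset (Site d)} (hg : DependsOn g (D : Set (Site d)))
    (i : Site d) :
    DependsOn (fun ω => g (shift (-i) ω)) ((D.image (· + i) : Finset (Site d)) : Set (Site d)) := by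
  intro x y hxy
  refine hg fun k hk => ?_
  simp only [shift]
  exact hxy _ (by simpa using hk)

lemma zr_int_shift {μ : Measure (Site d → Ω₀)} (hμ : TransInv μ) {g : (Site d → Ω₀) → ℝ}
    {D : Finset (Site d)} (hg : DependsOn g (D : Set (Site d))) (i : Site d) :
    ∫ ω, g (shift (-i) ω) ∂μ = ∫ ω, g ω ∂μ := by
  conv_rhs => rw [← hμ (-i)]
  rw [integral_map (zr_shift_meas _).aemeasurable (zr_meas hg).aestronglyMeasurable]

lemma zr_specInt_shift {γ : Specification (Site d) Ω₀} (hTI : TransInvSpec γ)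
    {g : (Site d → Ω₀) → ℝ} {D : Finset (Site d)} (hg : DependsOn g (D : Set (Site d)))
    (Λ : Finset (Site d)) (i : Site d) (ω : Site d → Ω₀) :
    specInt γ (Λ.image (· + i)) (fun x => g (shift (-i) x)) ω = specInt γ Λ g (shift (-i) ω) := by
  have h := hTI i Λ (shift (-i) ω)
  rw [zr_shift_shift] at h
  unfold specInt
  rw [h, integral_map (zr_shift_meas _).aemeasurable
    (zr_meas (zr_dep_shift hg i)).aestronglyMeasurable]
  simp only [zr_shift_shift']

lemma zr_telescope {h : Finset (Site d) → ℝ} {B : Finset (Site d)} {e : ℝ}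
    (h0 : ∀ Δ ⊆ B, 0 ≤ h Δ) (hm : ∀ Δ ⊆ B, ∀ Δ' ⊆ Δ, h Δ' ≤ h Δ) {α : Type*}
    (C L : α → Finset (Site d)) (hLC : ∀ j, L j ⊆ C j) (hdisj : ∀ j j', j ≠ j' → Disjoint (C j) (C j'))
    (he : ∀ j, ∀ Δ ⊆ B, C j ⊆ Δ → e ≤ h Δ - h (Δ \ L j)) (J : Finset α) (hJ : ∀ j ∈ J, C j ⊆ B) :
    J.card * e ≤ h (J.biUnion C) := by
  induction J using Finset.induction_on with
  | empty => simpa using h0 ∅ (by simp)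
  | insert a J ha ih =>
    have ih := ih fun j hj => hJ j (Finset.mem_insert_of_mem hj)
    have hB : (insert a J).biUnion C ⊆ B := Finset.biUnion_subset.2 hJ
    have h1 := he a _ hB (by
      rw [Finset.biUnion_insert]; exact Finset.subset_union_left)
    have h2 : h (J.biUnion C) ≤ h ((insert a J).biUnion C \ L a) := by
      refine hm _ (Finset.sdiff_subset.trans hB) _ ?_
      intro x hx
      rw [Finset.mem_sdiff, Finset.biUnion_insert]
      refine ⟨Finset.mem_union_right _ hx, fun hxa => ?_⟩
      obtain ⟨j, hj, hxj⟩ := Finset.mem_biUnion.1 hx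
      have hne : a ≠ j := fun h => ha (h ▸ hj)
      exact Finset.disjoint_left.1 (hdisj a j hne) (hLC a hxa) hxj
    rw [Finset.card_insert_of_notMem ha]
    push_cast
    linarith

lemma zr_cube_card (n : ℕ) : (cube d n).card = (2 * n + 1) ^ d := by
  unfold cube
  rw [Fintype.card_piFinset_const, Int.card_Icc]
  congr 1
  omega

lemma zr_mem_cube {n : ℕ} {x : Site d} : x ∈ cube d n ↔ ∀ k, -(n : ℤ) ≤ x k ∧ x k ≤ n := by
  simp [cube]

lemma zr_exists_cube (D : Finset (Site d)) : ∃ r, D ⊆ cube d r := by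
  induction D using Finset.induction_on with
  | empty => exact ⟨0, by simp⟩
  | insert a D _ ih =>
    obtain ⟨r, hr⟩ := ih
    refine ⟨r + ∑ k, (a k).natAbs, ?_⟩
    intro x hx
    rw [zr_mem_cube]
    intro k
    rcases Finset.mem_insert.1 hx with rfl | hx
    · have : (x k).natAbs ≤ ∑ k, (x k).natAbs :=
        Finset.single_le_sum (f := fun k => (x k).natAbs) (fun _ _ => Nat.zero_le _)
          (Finset.mem_univ k)
      omega
    · have := zr_mem_cube.1 (hr hx) k
      omega

/-- the tile with index `j` -/
def zrTile (d r : ℕ) (j : Site d) : Finset (Site d) :=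
  (cube d r).image (· + fun k => (2 * (r : ℤ) + 1) * j k)

lemma zr_mem_tile {r : ℕ} {j x : Site d} : x ∈ zrTile d r j ↔
    ∀ k, -(r : ℤ) ≤ x k - (2 * (r : ℤ) + 1) * j k ∧ x k - (2 * (r : ℤ) + 1) * j k ≤ r := by
  unfold zrTile
  rw [Finset.mem_image]
  constructor
  · rintro ⟨y, hy, rfl⟩ k
    simpa using zr_mem_cube.1 hy k
  · intro h
    refine ⟨fun k => x k - (2 * (r : ℤ) + 1) * j k, zr_mem_cube.2 h, ?_⟩
    ext k; simp

lemma zr_tile_disj (r : ℕ) (j j' : Site d) (hne : j ≠ j') :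
    Disjoint (zrTile d r j) (zrTile d r j') := by
  rw [Finset.disjoint_left]
  intro x hx hx'
  apply hne
  ext k
  have h1 := zr_mem_tile.1 hx k
  have h2 := zr_mem_tile.1 hx' k
  rcases lt_trichotomy (j k) (j' k) with h | h | h
  · exfalso
    have : (2 * (r : ℤ) + 1) * (j k + 1) ≤ (2 * (r : ℤ) + 1) * j' k :=
      mul_le_mul_of_nonneg_left (by omega) (by positivity)
    rw [mul_add] at this
    omega
  · exact h
  · exfalso
    have : (2 * (r : ℤ) + 1) * (j' k + 1) ≤ (2 * (r : ℤ) + 1) * j k :=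
      mul_le_mul_of_nonneg_left (by omega) (by positivity)
    rw [mul_add] at this
    omega

lemma zr_tile_sub (r m : ℕ) (j : Site d) (hj : j ∈ cube d m) :
    zrTile d r j ⊆ cube d (r + (2 * r + 1) * m) := by
  intro x hx
  rw [zr_mem_cube]
  intro k
  have h1 := zr_mem_tile.1 hx k
  have h2 := zr_mem_cube.1 hj k
  have h3 : (2 * (r : ℤ) + 1) * j k ≤ (2 * (r : ℤ) + 1) * m :=
    mul_le_mul_of_nonneg_left h2.2 (by positivity)
  have h4 : (2 * (r : ℤ) + 1) * (-m) ≤ (2 * (r : ℤ) + 1) * j k :=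
    mul_le_mul_of_nonneg_left h2.1 (by positivity)
  push_cast
  constructor <;> linarith

lemma zr_main {γ : Specification (Site d) Ω₀} (hTI : TransInvSpec γ)
    {μ ν : Measure (Site d → Ω₀)} [IsProbabilityMeasure μ] {θ : Site d → Ω₀}
    (hν : IsLimitWithBoundary γ θ ν) (hent : EntDensityZero μ ν) (hμ : TransInv μ)
    {D E Λ : Finset (Site d)} {g u : (Site d → Ω₀) → ℝ} (hg : DependsOn g (D : Set (Site d)))
    (hu : DependsOn u (E : Set (Site d))) (hE : Disjoint E Λ)
    (hle : ∀ ω, specInt γ Λ g ω ≤ u ω) : ∫ ω, g ω ∂μ ≤ ∫ ω, u ω ∂μ := by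
  have := hν.1
  by_contra! hlt
  obtain ⟨M, hM0, hM⟩ := zr_bdd hg
  set δ₀ := ∫ ω, g ω ∂μ - ∫ ω, u ω ∂μ with hδ₀
  have hδ₀pos : 0 < δ₀ := sub_pos.2 hlt
  set e := δ₀ ^ 2 / (4 * M ^ 2) with he
  have hepos : 0 < e := by positivity
  have key : ∀ (i : Site d) (Δ : Finset (Site d)), restrictTo Δ μ ≪ restrictTo Δ ν →
      (D ∪ E ∪ Λ).image (· + i) ⊆ Δ →
      e ≤ zrEnt Δ μ ν - zrEnt (Δ \ Λ.image (· + i)) μ ν := by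
    intro i Δ hac hsub
    have hs : Δ \ Λ.image (· + i) ⊆ Δ := Finset.sdiff_subset
    have hDs : D.image (· + i) ⊆ Δ := (Finset.image_subset_image (by
      intro x hx; simp [hx])).trans hsub
    have hEs : E.image (· + i) ⊆ Δ \ Λ.image (· + i) := by
      intro x hx
      rw [Finset.mem_sdiff]
      refine ⟨hsub (Finset.image_subset_image (by intro x hx; simp [hx]) hx), fun hx' => ?_⟩
      obtain ⟨y, hy, rfl⟩ := Finset.mem_image.1 hx
      obtain ⟨z, hz, hzy⟩ := Finset.mem_image.1 hx'
      have : z = y := add_right_cancel hzy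
      subst this
      exact Finset.disjoint_left.1 hE hy hz
    have hgi := zr_dep_shift hg i
    have hui := zr_dep_shift hu i
    have h1 := zr_pinsker hs hac (zr_dep_mono hgi (by exact_mod_cast hDs))
      (M := M) (δ := δ₀ / (4 * M)) (fun ω => hM _) hM0 (by positivity)
    have h2 := zr_limit_le γ θ ν hν (Λ.image (· + i)) (Δ \ Λ.image (· + i)) _ _
      Finset.sdiff_disjoint (zr_dens_dep _ μ ν) (zr_dens_nonneg _ μ ν) hgi hui (fun ω => by
        rw [zr_specInt_shift hTI hg]; exact hle _)
    rw [zr_dens_int (zr_ac_mono hs hac) (zr_dep_mono hui (by exact_mod_cast hEs)),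
      zr_int_shift hμ hu] at h2
    rw [zr_int_shift hμ hg] at h1
    set K := zrEnt Δ μ ν - zrEnt (Δ \ Λ.image (· + i)) μ ν
    have h3 := (le_abs_self _).trans h1
    have h4 : δ₀ ≤ M * (K / (2 * (δ₀ / (4 * M))) + 2 * (δ₀ / (4 * M))) := by linarith
    have h5 : M * (K / (2 * (δ₀ / (4 * M))) + 2 * (δ₀ / (4 * M))) = 2 * M ^ 2 * K / δ₀ + δ₀ / 2 := by
      field_simp
      ring
    rw [h5] at h4
    have h6 : δ₀ / 2 ≤ 2 * M ^ 2 * K / δ₀ := by linarith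
    rw [le_div_iff₀ hδ₀pos] at h6
    rw [he, div_le_iff₀ (by positivity)]
    nlinarith
  obtain ⟨r, hr⟩ := zr_exists_cube (D ∪ E ∪ Λ)
  have lower : ∀ m : ℕ, ENNReal.ofReal ((cube d m).card * e) ≤
      relEnt (cube d (r + (2 * r + 1) * m)) μ ν := by
    intro m
    unfold relEnt
    split_ifs with hac
    · refine ENNReal.ofReal_le_ofReal ?_
      set B := cube d (r + (2 * r + 1) * m)
      have hsubB : ∀ j ∈ cube d m, zrTile d r j ⊆ B := fun j hj => zr_tile_sub r m j hj
      have h1 := zr_telescope (h := fun Δ => zrEnt Δ μ ν) (B := B) (e := e)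
        (fun Δ hΔ => zrEnt_nonneg (zr_ac_mono hΔ hac))
        (fun Δ hΔ Δ' hΔ' => zrEnt_mono hΔ' (zr_ac_mono hΔ hac))
        (fun j => zrTile d r j)
        (fun j => Λ.image (· + fun k => (2 * (r : ℤ) + 1) * j k))
        (fun j => Finset.image_subset_image (Finset.subset_union_right.trans hr))
        (fun j j' h => zr_tile_disj r j j' h)
        (fun j Δ hΔ hC => key _ Δ (zr_ac_mono hΔ hac)
          ((Finset.image_subset_image hr).trans hC)) (cube d m) hsubB
      exact h1.trans (zrEnt_mono (Finset.biUnion_subset.2 hsubB) hac)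
    · exact le_top
  have htend : Tendsto (fun m : ℕ => r + (2 * r + 1) * m) atTop atTop :=
    tendsto_atTop_mono (fun m => by simp only [id]; nlinarith [Nat.zero_le (r * m)]) tendsto_id
  have hlim := hent.comp htend
  have hev := hlim.eventually (gt_mem_nhds (b := (0 : ℝ≥0∞)) (a := ENNReal.ofReal (e / (2 * (r : ℝ) + 1) ^ d))
    (ENNReal.ofReal_pos.2 (by positivity)))
  obtain ⟨m, hm⟩ := hev.exists
  simp only [Function.comp] at hm
  refine absurd hm (not_lt.2 ?_)
  have hcard : ((cube d (r + (2 * r + 1) * m)).card : ℝ≥0∞)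
      = ENNReal.ofReal ((2 * r + 1) ^ d * (cube d m).card) := by
    rw [← ENNReal.ofReal_natCast, zr_cube_card, zr_cube_card]
    congr 1
    push_cast
    rw [← mul_pow]
    congr 1
    ring
  have hcpos : (0 : ℝ) < (cube d m).card := by
    rw [zr_cube_card]; positivity
  rw [hcard]
  refine le_trans (le_of_eq ?_) (ENNReal.div_le_div_right (lower m) _)
  rw [← ENNReal.ofReal_div_of_pos (by positivity)]
  congr 1
  field_simp

end Lattice

section Final

variable {ι Ω₀ : Type*} [Finite Ω₀] [MeasurableSpace Ω₀] [DiscreteMeasurableSpace Ω₀]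
  [LinearOrder Ω₀] [BoundedOrder Ω₀]

lemma zr_decomp {f : (ι → Ω₀) → ℝ} {Δ : Finset ι} (hf : DependsOn f (Δ : Set ι)) :
    ∃ g₁ g₂ : (ι → Ω₀) → ℝ, Monotone g₁ ∧ Monotone g₂ ∧ DependsOn g₁ (Δ : Set ι) ∧
      DependsOn g₂ (Δ : Set ι) ∧ ∀ ω, f ω = g₁ ω - g₂ ω := by
  obtain ⟨M, hM0, hM⟩ := zr_bdd hf
  have hrank : ∃ ρ : Ω₀ → ℕ, StrictMono ρ := by
    have := Fintype.ofFinite Ω₀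
    refine ⟨fun c => (Finset.univ.filter (· < c)).card, fun a b hab => ?_⟩
    refine Finset.card_lt_card ?_
    rw [Finset.ssubset_iff_of_subset]
    · exact ⟨a, by simpa using hab, by simp⟩
    · intro x hx
      simp only [Finset.mem_filter, Finset.mem_univ, true_and] at hx ⊢
      exact hx.trans hab
  obtain ⟨ρ, hρ⟩ := hrank
  let m : (ι → Ω₀) → ℕ := fun ω => ∑ x ∈ Δ, ρ (ω x)
  have hm : DependsOn m (Δ : Set ι) := fun x y hxy =>
    Finset.sum_congr rfl fun i hi => by rw [hxy i (by simpa using hi)]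
  have hmm : Monotone m := fun x y hxy => Finset.sum_le_sum fun i _ => hρ.monotone (hxy i)
  refine ⟨fun ω => f ω + 2 * M * m ω, fun ω => 2 * M * m ω, ?_, ?_,
    zr_dep_comp2 hf hm (fun a b => a + 2 * M * b), zr_dep_comp hm (fun b => 2 * M * (b : ℝ)),
    fun ω => by ring⟩
  · intro x y hxy
    simp only
    by_cases h : ∀ i ∈ (Δ : Set ι), x i = y i
    · rw [hf h, hm h]
    · push Not at h
      obtain ⟨i, hi, hne⟩ := h
      have h1 : m x < m y := Finset.sum_lt_sum (fun i _ => hρ.monotone (hxy i))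
        ⟨i, by simpa using hi, hρ (lt_of_le_of_ne (hxy i) hne)⟩
      have h2 : (m x : ℝ) + 1 ≤ m y := by exact_mod_cast h1
      have h3 := abs_le.1 (hM x)
      have h4 := abs_le.1 (hM y)
      nlinarith
  · intro x y hxy
    have : (m x : ℝ) ≤ m y := by exact_mod_cast hmm hxy
    simp only
    gcongr

lemma zr_splice_le_top (S : Set ι) (ω : ι → Ω₀) : ω ≤ splice S ω (fun _ => (⊤ : Ω₀)) := by
  intro x; unfold splice; split_ifs <;> simp

lemma zr_bot_le_splice (S : Set ι) (ω : ι → Ω₀) : splice S ω (fun _ => (⊥ : Ω₀)) ≤ ω := by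
  intro x; unfold splice; split_ifs <;> simp

lemma zr_splice_top_anti {S T : Set ι} (h : S ⊆ T) (ω : ι → Ω₀) :
    splice T ω (fun _ => (⊤ : Ω₀)) ≤ splice S ω (fun _ => (⊤ : Ω₀)) := by
  intro x; unfold splice; split_ifs with h1 h2 <;> first | exact le_rfl | exact le_top | skip
  exact absurd (h (by assumption)) h1

lemma zr_splice_bot_mono {S T : Set ι} (h : S ⊆ T) (ω : ι → Ω₀) :
    splice S ω (fun _ => (⊥ : Ω₀)) ≤ splice T ω (fun _ => (⊥ : Ω₀)) := by
  intro x; unfold splice; split_ifs with h1 h2 <;> first | exact le_rfl | exact bot_le | skip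
  exact absurd (h h1) (by assumption)

lemma zr_le_U {γ γp : Specification ι Ω₀} (hmono : MonoPreserving γ)
    (hγp : IsDirLimitSpec γ γp (fun _ => (⊤ : Ω₀))) {g : (ι → Ω₀) → ℝ} {D : Finset ι}
    (hg : DependsOn g (D : Set ι)) (hgm : Monotone g) (Λ S : Finset ι) (ω : ι → Ω₀) :
    specInt γp Λ g ω ≤ zrU γ (fun _ => (⊤ : Ω₀)) Λ S g ω := by
  refine le_of_tendsto (hγp Λ g (zr_local_iff.2 ⟨D, hg⟩) ω) ?_
  filter_upwards [eventually_ge_atTop S] with T hT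
  exact hmono Λ g (zr_meas hg) hgm (zr_splice_top_anti (by exact_mod_cast hT) ω)

lemma zr_L_le {γ γm : Specification ι Ω₀} (hmono : MonoPreserving γ)
    (hγm : IsDirLimitSpec γ γm (fun _ => (⊥ : Ω₀))) {g : (ι → Ω₀) → ℝ} {D : Finset ι}
    (hg : DependsOn g (D : Set ι)) (hgm : Monotone g) (Λ S : Finset ι) (ω : ι → Ω₀) :
    zrU γ (fun _ => (⊥ : Ω₀)) Λ S g ω ≤ specInt γm Λ g ω := by
  refine ge_of_tendsto (hγm Λ g (zr_local_iff.2 ⟨D, hg⟩) ω) ?_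
  filter_upwards [eventually_ge_atTop S] with T hT
  exact hmono Λ g (zr_meas hg) hgm (zr_splice_bot_mono (by exact_mod_cast hT) ω)

lemma zr_m_le_p {γ γp γm : Specification ι Ω₀} (hmono : MonoPreserving γ)
    (hγp : IsDirLimitSpec γ γp (fun _ => (⊤ : Ω₀)))
    (hγm : IsDirLimitSpec γ γm (fun _ => (⊥ : Ω₀))) {g : (ι → Ω₀) → ℝ} {D : Finset ι}
    (hg : DependsOn g (D : Set ι)) (hgm : Monotone g) (Λ : Finset ι) (ω : ι → Ω₀) :
    specInt γm Λ g ω ≤ specInt γp Λ g ω := by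
  refine le_of_tendsto_of_tendsto' (hγm Λ g (zr_local_iff.2 ⟨D, hg⟩) ω)
    (hγp Λ g (zr_local_iff.2 ⟨D, hg⟩) ω) fun S => ?_
  exact hmono Λ g (zr_meas hg) hgm ((zr_bot_le_splice _ ω).trans (zr_splice_le_top _ ω))

lemma zr_dep_ev [TopologicalSpace Ω₀] [DiscreteTopology Ω₀] {f : (ι → Ω₀) → ℝ} {D : Finset ι}
    (hf : DependsOn f (D : Set ι)) (ω : ι → Ω₀) : ∀ᶠ x in 𝓝 ω, f x = f ω := by
  have : ∀ᶠ x in 𝓝 ω, ∀ i ∈ D, x i = ω i := by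
    rw [Filter.eventually_all_finset]
    intro i _
    have h := (continuous_apply (A := fun _ : ι => Ω₀) i).continuousAt (x := ω)
    exact h.eventually (p := fun c => c = ω i) ((isOpen_discrete {ω i}).mem_nhds rfl)
  filter_upwards [this] with x hx
  exact hf fun i hi => hx i (by simpa using hi)

lemma zr_cont_mono [TopologicalSpace Ω₀] [DiscreteTopology Ω₀]
    {γ γp γm : Specification ι Ω₀} (hmono : MonoPreserving γ)
    (hγp : IsDirLimitSpec γ γp (fun _ => (⊤ : Ω₀)))
    (hγm : IsDirLimitSpec γ γm (fun _ => (⊥ : Ω₀))) {g : (ι → Ω₀) → ℝ} {D : Finset ι}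
    (hg : DependsOn g (D : Set ι)) (hgm : Monotone g) (Λ : Finset ι) (ω : ι → Ω₀)
    (heq : specInt γp Λ g ω = specInt γm Λ g ω) {q : (ι → Ω₀) → ℝ}
    (hq1 : ∀ x, specInt γm Λ g x ≤ q x) (hq2 : ∀ x, q x ≤ specInt γp Λ g x) :
    ContinuousAt q ω := by
  have hqω : q ω = specInt γp Λ g ω := le_antisymm (hq2 ω) (heq ▸ hq1 ω)
  have hqω' : q ω = specInt γm Λ g ω := hqω.trans heq
  have tp := hγp Λ g (zr_local_iff.2 ⟨D, hg⟩) ω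
  have tm := hγm Λ g (zr_local_iff.2 ⟨D, hg⟩) ω
  rw [← hqω] at tp
  rw [← hqω'] at tm
  refine tendsto_order.2 ⟨fun a ha => ?_, fun a ha => ?_⟩
  · obtain ⟨S, hS⟩ := ((tendsto_order.1 tm).1 a ha).exists
    filter_upwards [zr_dep_ev (zrU_dep γ (fun _ => (⊥ : Ω₀)) Λ S g) ω] with x hx
    calc a < _ := hS
      _ = _ := hx.symm
      _ ≤ _ := zr_L_le hmono hγm hg hgm Λ S x
      _ ≤ _ := hq1 x
  · obtain ⟨S, hS⟩ := ((tendsto_order.1 tp).2 a ha).exists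
    filter_upwards [zr_dep_ev (zrU_dep γ (fun _ => (⊤ : Ω₀)) Λ S g) ω] with x hx
    calc q x ≤ _ := hq2 x
      _ ≤ _ := zr_le_U hmono hγp hg hgm Λ S x
      _ = _ := hx
      _ < a := hS

lemma zr_specInt_sub (γ : Specification ι Ω₀) (Λ : Finset ι) {f g₁ g₂ : (ι → Ω₀) → ℝ}
    {D : Finset ι} (h1 : DependsOn g₁ (D : Set ι)) (h2 : DependsOn g₂ (D : Set ι))
    (hf : ∀ ω, f ω = g₁ ω - g₂ ω) :
    specInt γ Λ f = fun ω => specInt γ Λ g₁ ω - specInt γ Λ g₂ ω := by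
  ext ω
  have := γ.isProb Λ ω
  unfold specInt
  rw [← integral_sub (zr_int h1 _) (zr_int h2 _)]
  simp only [hf]

lemma zr_contSet [TopologicalSpace Ω₀] [DiscreteTopology Ω₀]
    {γ γp γm : Specification ι Ω₀} (hmono : MonoPreserving γ)
    (hγp : IsDirLimitSpec γ γp (fun _ => (⊤ : Ω₀)))
    (hγm : IsDirLimitSpec γ γm (fun _ => (⊥ : Ω₀))) :
    agreeSet γp γm ⊆ contSet γp ∧ agreeSet γp γm ⊆ contSet γm := by
  constructor
  · intro ω hω Λ f hf
    obtain ⟨D, hD⟩ := zr_local_iff.1 hf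
    obtain ⟨g₁, g₂, m1, m2, d1, d2, hfg⟩ := zr_decomp hD
    rw [zr_specInt_sub γp Λ d1 d2 hfg]
    exact (zr_cont_mono hmono hγp hγm d1 m1 Λ ω (hω Λ _ (zr_local_iff.2 ⟨D, d1⟩))
      (zr_m_le_p hmono hγp hγm d1 m1 Λ) (fun _ => le_rfl)).sub
      (zr_cont_mono hmono hγp hγm d2 m2 Λ ω (hω Λ _ (zr_local_iff.2 ⟨D, d2⟩))
      (zr_m_le_p hmono hγp hγm d2 m2 Λ) (fun _ => le_rfl))
  · intro ω hω Λ f hf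
    obtain ⟨D, hD⟩ := zr_local_iff.1 hf
    obtain ⟨g₁, g₂, m1, m2, d1, d2, hfg⟩ := zr_decomp hD
    rw [zr_specInt_sub γm Λ d1 d2 hfg]
    exact (zr_cont_mono hmono hγp hγm d1 m1 Λ ω (hω Λ _ (zr_local_iff.2 ⟨D, d1⟩))
      (fun _ => le_rfl) (zr_m_le_p hmono hγp hγm d1 m1 Λ)).sub
      (zr_cont_mono hmono hγp hγm d2 m2 Λ ω (hω Λ _ (zr_local_iff.2 ⟨D, d2⟩))
      (fun _ => le_rfl) (zr_m_le_p hmono hγp hγm d2 m2 Λ))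

lemma zr_sdiff_disj (S Λ : Finset ι) : Disjoint (S \ Λ) Λ := Finset.sdiff_disjoint

lemma zr_specInt_integrable (γ : Specification ι Ω₀) (Λ : Finset ι) {f : (ι → Ω₀) → ℝ}
    {D : Finset ι} (hf : DependsOn f (D : Set ι)) (μ : Measure (ι → Ω₀)) [IsFiniteMeasure μ] :
    Integrable (specInt γ Λ f) μ := by
  obtain ⟨M, -, hM⟩ := zr_bdd hf
  exact Integrable.of_bound (zr_specInt_meas γ Λ (zr_meas hf)).aestronglyMeasurable M
    (Eventually.of_forall fun ω => zr_specInt_bdd γ Λ hM ω)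

lemma zr_tend_int [Countable ι] {γ γ' : Specification ι Ω₀} {θ : ι → Ω₀}
    (h : IsDirLimitSpec γ γ' θ) {g : (ι → Ω₀) → ℝ} {D : Finset ι} (hg : DependsOn g (D : Set ι))
    (Λ : Finset ι) (μ : Measure (ι → Ω₀)) [IsFiniteMeasure μ] :
    Tendsto (fun S : Finset ι => ∫ ω, zrU γ θ Λ S g ω ∂μ) atTop
      (𝓝 (∫ ω, specInt γ' Λ g ω ∂μ)) := by
  obtain ⟨M, -, hM⟩ := zr_bdd hg
  refine tendsto_integral_filter_of_dominated_convergence (fun _ => M) ?_ ?_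
    (integrable_const _) ?_
  · exact Eventually.of_forall fun S => (zr_meas (zrU_dep γ θ Λ S g)).aestronglyMeasurable
  · exact Eventually.of_forall fun S => Eventually.of_forall fun ω => zr_specInt_bdd γ Λ hM _
  · exact Eventually.of_forall fun ω => h Λ g (zr_local_iff.2 ⟨D, hg⟩) ω

lemma zr_gibbs_of {γ : Specification ι Ω₀} {μ : Measure (ι → Ω₀)} [IsProbabilityMeasure μ]
    (h : ∀ (Λ D : Finset ι) (f : (ι → Ω₀) → ℝ), DependsOn f (D : Set ι) →
      ∫ ω, specInt γ Λ f ω ∂μ = ∫ ω, f ω ∂μ) : IsGibbs γ μ := by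
  intro Λ
  have hk := zr_k_meas γ Λ
  have hprob : IsProbabilityMeasure (μ.bind (γ.k Λ)) := by
    constructor
    rw [Measure.bind_apply MeasurableSet.univ hk.aemeasurable]
    have : ∀ ω, γ.k Λ ω Set.univ = 1 := fun ω => (γ.isProb Λ ω).measure_univ
    simp [this]
  refine ext_of_generate_finite (measurableCylinders fun _ : ι => Ω₀)
    generateFrom_measurableCylinders.symm isPiSystem_measurableCylinders (fun A hA => ?_) (by simp)
  have hAm : MeasurableSet A := MeasurableSet.of_mem_measurableCylinders hA
  obtain ⟨D, B, -, rfl⟩ := (mem_measurableCylinders A).1 hA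
  set A : Set (ι → Ω₀) := cylinder (α := fun _ : ι => Ω₀) D B
  have hdep : DependsOn (A.indicator (fun _ => (1 : ℝ))) (D : Set ι) := by
    intro x y hxy
    have : x ∈ A ↔ y ∈ A := by
      simp only [A, mem_cylinder]
      have : D.restrict x = D.restrict y := by
        ext i; exact hxy i (by simp)
      rw [this]
    by_cases hx : x ∈ A
    · rw [Set.indicator_of_mem hx, Set.indicator_of_mem (this.1 hx)]
    · rw [Set.indicator_of_notMem hx, Set.indicator_of_notMem (fun hy => hx (this.2 hy))]
  have h1 := h Λ D _ hdep
  have h2 := zr_integral_bind μ (γ.k Λ) hk (γ.isProb Λ) (zr_int hdep _)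
  have h3 : ∫ ω, A.indicator (fun _ => (1 : ℝ)) ω ∂(μ.bind (γ.k Λ))
      = ∫ ω, A.indicator (fun _ => (1 : ℝ)) ω ∂μ := h2.trans h1
  rw [integral_indicator_const _ hAm, integral_indicator_const _ hAm] at h3
  simp only [smul_eq_mul, mul_one, Measure.real] at h3
  exact (ENNReal.toReal_eq_toReal_iff' (measure_ne_top _ _) (measure_ne_top _ _)).1 h3

lemma zr_agree_ae {γp γm : Specification ι Ω₀} {μ : Measure (ι → Ω₀)} [IsProbabilityMeasure μ]
    (hfull : μ (agreeSet γp γm) = 1) (Λ D : Finset ι) {f : (ι → Ω₀) → ℝ}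
    (hf : DependsOn f (D : Set ι)) : ∀ᵐ ω ∂μ, specInt γp Λ f ω = specInt γm Λ f ω := by
  have hm : MeasurableSet {ω | specInt γp Λ f ω = specInt γm Λ f ω} :=
    measurableSet_eq_fun (zr_specInt_meas γp Λ (zr_meas hf)) (zr_specInt_meas γm Λ (zr_meas hf))
  have h1 : μ {ω | specInt γp Λ f ω = specInt γm Λ f ω} = 1 := by
    refine le_antisymm prob_le_one ?_
    rw [← hfull]
    exact measure_mono fun ω hω => hω Λ f (zr_local_iff.2 ⟨D, hf⟩)
  exact (prob_compl_eq_zero_iff hm).2 h1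

lemma zr_conclude {d : ℕ} [TopologicalSpace Ω₀] [DiscreteTopology Ω₀]
    {γ γp γm : Specification (Site d) Ω₀} (hTI : TransInvSpec γ) (hmono : MonoPreserving γ)
    (hγp : IsDirLimitSpec γ γp (fun _ => (⊤ : Ω₀)))
    (hγm : IsDirLimitSpec γ γm (fun _ => (⊥ : Ω₀)))
    {ν μ : Measure (Site d → Ω₀)} {θ : Site d → Ω₀} (hν : IsLimitWithBoundary γ θ ν)
    (hμ : IsProbabilityMeasure μ) (hμTI : TransInv μ) (hfull : μ (agreeSet γp γm) = 1)
    (hent : EntDensityZero μ ν) : IsGibbs γp μ ∧ IsGibbs γm μ := by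
  have hpm : ∀ (Λ D : Finset (Site d)) (f : (Site d → Ω₀) → ℝ),
      DependsOn f (D : Set (Site d)) →
      ∫ ω, specInt γp Λ f ω ∂μ = ∫ ω, specInt γm Λ f ω ∂μ := fun Λ D f hf =>
    integral_congr_ae (zr_agree_ae hfull Λ D hf)
  have hmonoeq : ∀ (Λ D : Finset (Site d)) (g : (Site d → Ω₀) → ℝ),
      DependsOn g (D : Set (Site d)) → Monotone g →
      ∫ ω, specInt γp Λ g ω ∂μ = ∫ ω, g ω ∂μ := by
    intro Λ D g hg hgm
    have up : ∫ ω, g ω ∂μ ≤ ∫ ω, specInt γp Λ g ω ∂μ := by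
      refine ge_of_tendsto' (zr_tend_int hγp hg Λ μ) fun S => ?_
      exact zr_main hTI hν hent hμTI hg (zrU_dep γ _ Λ S g) (zr_sdiff_disj S Λ)
        fun ω => hmono Λ g (zr_meas hg) hgm (zr_splice_le_top _ ω)
    have low : ∫ ω, specInt γm Λ g ω ∂μ ≤ ∫ ω, g ω ∂μ := by
      refine le_of_tendsto' (zr_tend_int hγm hg Λ μ) fun S => ?_
      have h := zr_main hTI hν hent hμTI (Λ := Λ) (zr_dep_comp hg (fun t => -t))
        (zr_dep_comp (zrU_dep γ (fun _ => (⊥ : Ω₀)) Λ S g) (fun t => -t)) (zr_sdiff_disj S Λ)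
        (fun ω => by
          have h1 : specInt γ Λ (fun x => - g x) ω = - specInt γ Λ g ω := integral_neg _
          rw [h1]
          exact neg_le_neg (hmono Λ g (zr_meas hg) hgm (zr_bot_le_splice (S : Set (Site d)) ω)))
      rw [integral_neg, integral_neg] at h
      exact neg_le_neg_iff.1 h
    rw [← hpm Λ D g hg] at low
    exact le_antisymm low up
  have hall : ∀ (Λ D : Finset (Site d)) (f : (Site d → Ω₀) → ℝ),
      DependsOn f (D : Set (Site d)) → ∫ ω, specInt γp Λ f ω ∂μ = ∫ ω, f ω ∂μ := by
    intro Λ D f hf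
    obtain ⟨g₁, g₂, m1, m2, d1, d2, hfg⟩ := zr_decomp hf
    rw [zr_specInt_sub γp Λ d1 d2 hfg, integral_sub (zr_specInt_integrable γp Λ d1 μ)
      (zr_specInt_integrable γp Λ d2 μ), hmonoeq Λ D g₁ d1 m1, hmonoeq Λ D g₂ d2 m2,
      ← integral_sub (zr_int d1 _) (zr_int d2 _)]
    simp only [hfg]
  exact ⟨zr_gibbs_of hall, zr_gibbs_of fun Λ D f hf => by rw [← hpm Λ D f hf, hall Λ D f hf]⟩

end Final

/-- If `μ` is translation invariant with `h(μ|μ⁺) = 0` and `μ(Ω_±) = 1`, then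
`μ ∈ 𝒢(γ⁽⁺⁾)` and `μ` is almost quasilocal; and the analogous statement with "+"
and "−" interchanged. -/
theorem zero_relEnt_fullAgree_implies_consistency
    {Ω₀ : Type*} [Fintype Ω₀] [MeasurableSpace Ω₀] [DiscreteMeasurableSpace Ω₀]
    [LinearOrder Ω₀] [BoundedOrder Ω₀] [TopologicalSpace Ω₀] [DiscreteTopology Ω₀] {d : ℕ}
    (γ : Specification (Site d) Ω₀) (hTI : TransInvSpec γ) (hmono : MonoPreserving γ)
    (γp γm : Specification (Site d) Ω₀)
    (hγp : IsDirLimitSpec γ γp (fun _ => (⊤ : Ω₀)))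
    (hγm : IsDirLimitSpec γ γm (fun _ => (⊥ : Ω₀)))
    (μp μm : Measure (Site d → Ω₀))
    (hμp : IsLimitWithBoundary γ (fun _ => (⊤ : Ω₀)) μp)
    (hμm : IsLimitWithBoundary γ (fun _ => (⊥ : Ω₀)) μm)
    (μ : Measure (Site d → Ω₀)) (hμ : IsProbabilityMeasure μ) (hμTI : TransInv μ)
    (hfull : μ (agreeSet γp γm) = 1) :
    (EntDensityZero μ μp → IsGibbs γp μ ∧ AlmostQuasilocal μ) ∧
    (EntDensityZero μ μm → IsGibbs γm μ ∧ AlmostQuasilocal μ) := by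
  obtain ⟨c1, c2⟩ := zr_contSet hmono hγp hγm
  have e1 : μ (contSet γp) = 1 := le_antisymm prob_le_one (hfull ▸ measure_mono c1)
  have e2 : μ (contSet γm) = 1 := le_antisymm prob_le_one (hfull ▸ measure_mono c2)
  constructor
  · intro h
    have hG := (zr_conclude hTI hmono hγp hγm hμp hμ hμTI hfull h).1
    exact ⟨hG, γp, hG, e1⟩
  · intro h
    have hG := (zr_conclude hTI hmono hγp hγm hμm hμ hμTI hfull h).2
    exact ⟨hG, γm, hG, e2⟩

end
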